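/- Let n be a positive integer with gcd(n,6)=1 and let (1)(a)(b)(c) be a minimal zero-sum sequence over ℤ/n whose index equals 2. Then for every g ∈ (ℤ/n)^*, exactly two of the four numbers (g)_n, (ga)_n, (gb)_n, (gc)_n lie in the open interval (0, n/2). -/

import Mathlib

/-- A sequence `a` of length `k` over `ℤ/n` is a minimal zero-sum sequence if it sums to zero
but no nonempty proper subsequence of it sums to zero. -/
def IsMinZeroSum (n : ℕ) {k : ℕ} (a : Fin k → ZMod n) : Prop :=
  (∑ j, a j = 0) ∧
    ∀ s : Finset (Fin k), s.Nonempty → s ≠ Finset.univ → ∑ j ∈ s, a j ≠ 0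

/-- The index of a sequence over `ℤ/n`: the minimum over units `g` of
`(1/n) · Σ_j (g·a_j)_n`, where `(x)_n` is the least non-negative residue. -/
noncomputable def seqIndex (n : ℕ) {k : ℕ} (a : Fin k → ZMod n) : ℚ :=
  if h : n = 0 then 0
  else
    haveI : NeZero n := ⟨h⟩
    (Finset.univ.inf' Finset.univ_nonempty
      (fun g : (ZMod n)ˣ => ∑ j, (((g : ZMod n) * a j).val : ℚ))) / n

/-- Every unit multiple of a sequence has residue sum at least `n` times the index. -/
theorem seqIndex_mul_le_sum_val (n : ℕ) [NeZero n] {k : ℕ} (v : Fin k → ZMod n) (g : (ZMod n)ˣ) :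
    seqIndex n v * n ≤ ((∑ j, ((g : ZMod n) * v j).val : ℕ) : ℚ) := by
  have hn : (n : ℚ) ≠ 0 := Nat.cast_ne_zero.mpr (NeZero.ne n)
  rw [seqIndex, dif_neg (NeZero.ne n), div_mul_cancel₀ _ hn]
  push_cast
  exact Finset.inf'_le (fun g : (ZMod n)ˣ => ∑ j, (((g : ZMod n) * v j).val : ℚ))
    (Finset.mem_univ g)

/-- The residue of a double, for an odd modulus, by the half in which the residue lies. -/
theorem ZMod.val_two_mul_add_ite {n : ℕ} [NeZero n] (hodd : Odd n) (x : ZMod n) :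
    (2 * x).val + n = 2 * x.val + n * (if 2 * x.val < n then 1 else 0) := by
  have hx := x.val_lt
  rw [two_mul, ZMod.val_add, ← two_mul]
  obtain ⟨m, hm⟩ := hodd
  split_ifs with h
  · rw [Nat.mod_eq_of_lt h]
    omega
  · rw [Nat.mod_eq_sub_mod (by omega), Nat.mod_eq_of_lt (by omega)]
    omega

/-- A sequence of four nonzero elements of index `2` has residue sum `2 * n` after
multiplication by any unit. -/
theorem sum_val_eq_of_seqIndex_eq_two (n : ℕ) [NeZero n] (v : Fin 4 → ZMod n)
    (hv : ∀ j, v j ≠ 0) (hind : seqIndex n v = 2) (g : (ZMod n)ˣ) :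
    ∑ j, ((g : ZMod n) * v j).val = 2 * n := by
  have lower (u : (ZMod n)ˣ) : 2 * n ≤ ∑ j, ((u : ZMod n) * v j).val := by
    have h := seqIndex_mul_le_sum_val n v u
    rw [hind] at h
    exact_mod_cast h
  have hneg : ∑ j, (((-g : (ZMod n)ˣ) : ZMod n) * v j).val
      + ∑ j, ((g : ZMod n) * v j).val = 4 * n := by
    rw [← Finset.sum_add_distrib, Finset.sum_congr rfl (g := fun _ => n)]
    · simp
    · intro j _
      have h0 : (g : ZMod n) * v j ≠ 0 := by simpa using hv j
      have hlt := ((g : ZMod n) * v j).val_lt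
      rw [Units.val_neg, neg_mul, ZMod.neg_val, if_neg h0]
      omega
  have h₁ := lower g
  have h₂ := lower (-g)
  omega

open Classical in
theorem stmt2 (n : ℕ) (hn : 0 < n) (h6 : Nat.gcd n 6 = 1) (a b c : ZMod n)
    (hmin : IsMinZeroSum n ![1, a, b, c])
    (hind : seqIndex n ![1, a, b, c] = 2) :
    ∀ g : (ZMod n)ˣ,
      (Finset.univ.filter (fun j : Fin 4 =>
        0 < ((g : ZMod n) * ![1, a, b, c] j).val ∧
        ((((g : ZMod n) * ![1, a, b, c] j).val : ℝ) < n / 2))).card = 2 := by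
  intro g
  have : NeZero n := ⟨hn.ne'⟩
  generalize ![1, a, b, c] = v at hmin hind ⊢
  have hv (j : Fin 4) : v j ≠ 0 := by
    have h := hmin.2 {j} (Finset.singleton_nonempty j)
      (fun h => by simpa using congrArg Finset.card h)
    simpa using h
  have hcop : Nat.Coprime 2 n :=
    (Nat.Coprime.coprime_dvd_right (by norm_num : 2 ∣ 6) h6).symm
  have hodd : Odd n := Nat.coprime_two_left.mp hcop
  have hg := sum_val_eq_of_seqIndex_eq_two n v hv hind g
  have h2g := sum_val_eq_of_seqIndex_eq_two n v hv hind (ZMod.unitOfCoprime 2 hcop * g)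
  have hsum := Finset.sum_congr rfl fun (j : Fin 4) (_ : j ∈ Finset.univ) =>
    ZMod.val_two_mul_add_ite hodd ((g : ZMod n) * v j)
  rw [Finset.sum_add_distrib, Finset.sum_add_distrib, ← Finset.mul_sum, ← Finset.mul_sum,
    ← Finset.card_filter, hg] at hsum
  simp only [Units.val_mul, ZMod.coe_unitOfCoprime, Nat.cast_ofNat, mul_assoc] at h2g
  rw [h2g] at hsum
  have hfilter : Finset.univ.filter (fun j : Fin 4 => 0 < ((g : ZMod n) * v j).val ∧
      ((((g : ZMod n) * v j).val : ℝ) < n / 2)) =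
      Finset.univ.filter (fun j : Fin 4 => 2 * ((g : ZMod n) * v j).val < n) := by
    ext j
    have h0 : 0 < ((g : ZMod n) * v j).val := ZMod.val_pos.mpr (by simpa using hv j)
    simp only [Finset.mem_filter, Finset.mem_univ, true_and, h0]
    rw [lt_div_iff₀ two_pos, mul_comm]
    exact_mod_cast Iff.rfl
  rw [hfilter]
  simp only [Finset.sum_const, Finset.card_univ, Fintype.card_fin, smul_eq_mul] at hsum
  have hmul := Nat.add_left_cancel (hsum.symm.trans (by ring : 2 * n + 4 * n = 2 * (2 * n) + n * 2))
  convert Nat.eq_of_mul_eq_mul_left hn hmul
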